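/- arXiv:2411.19699 — 4 statements merged into one kernel-verified Lean document; each statement's English description precedes it below -/
import Mathlib

section
/- Let R be a commutative ring, n a positive natural number whose image in R is a unit, and a a unit of R. Then the R-algebra R[V]/(Vⁿ − a) (that is, AdjoinRoot (Xⁿ − C a)) is étale over R — formally étale and of finite presentation — and the image of V (the adjoined root) is a unit of this algebra. -/
open Polynomial in
theorem adjoinRoot_pow_aux_unit (R : Type*) [CommRing R] (n : ℕ) (hn : 0 < n) (a : Rˣ) :
    IsUnit (AdjoinRoot.root (Polynomial.X ^ n - Polynomial.C (a : R))) := by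
  have h : AdjoinRoot.root (X ^ n - C (a : R)) ^ n = AdjoinRoot.of _ (a : R) := by
    have h := AdjoinRoot.eval₂_root (X ^ n - C (a : R))
    simpa [sub_eq_zero] using h
  refine (isUnit_pow_iff hn.ne').1 ?_
  rw [h]
  exact a.isUnit.map _

open Polynomial in
theorem adjoinRoot_pow_sub_unit_etale (R : Type*) [CommRing R] (n : ℕ) (hn : 0 < n)
    (hu : IsUnit (n : R)) (a : Rˣ) :
    Algebra.Etale R (AdjoinRoot (Polynomial.X ^ n - Polynomial.C (a : R))) ∧
      IsUnit (AdjoinRoot.root (Polynomial.X ^ n - Polynomial.C (a : R))) := by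
  have hroot := adjoinRoot_pow_aux_unit R n hn a
  refine ⟨?_, hroot⟩
  let P : StandardEtalePair R := ⟨X ^ n - C (a : R), monic_X_pow_sub_C _ hn.ne',
    derivative (X ^ n - C (a : R)), 1, 0, 1, by simp⟩
  have hg : IsUnit (AdjoinRoot.mk P.f P.g) := by
    have : AdjoinRoot.mk P.f P.g = AdjoinRoot.of P.f (n : R) * AdjoinRoot.root P.f ^ (n - 1) := by
      simp [P, derivative_X_pow]
    rw [this]
    exact (hu.map _).mul (hroot.pow _)
  have e : AdjoinRoot P.f ≃ₐ[AdjoinRoot P.f] Localization.Away (AdjoinRoot.mk P.f P.g) :=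
    IsLocalization.atUnit _ _ _ hg
  exact Algebra.Etale.of_equiv (P.equivAwayAdjoinRoot.trans (e.restrictScalars R).symm)
end

section
/- Let C and D be categories with zero objects and zero morphisms, and let F : C ⥤ D, G : D ⥤ C be functors with an adjunction F ⊣ G such that G is conservative (reflects isomorphisms). Let S be a family of objects of C with the property that any object X of C such that every morphism A ⟶ X with A ∈ S is the zero morphism must be a zero object. Then any object Y of D such that every morphism F(A) ⟶ Y with A ∈ S is the zero morphism is a zero object of D. -/
/-!
Let `C`, `D` be categories with zero morphisms and zero objects, `F ⊣ G` an
adjunction with `G` conservative, and `S` a family of objects of `C` detecting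
zero objects (any `X` receiving only zero morphisms from the members of `S` is
a zero object).  Then the family `F(S i)` detects zero objects of `D`.
-/

open CategoryTheory CategoryTheory.Limits

theorem leftAdjoint_image_detects_zero {C D : Type*} [Category C] [Category D]
    [HasZeroMorphisms C] [HasZeroMorphisms D] [HasZeroObject C] [HasZeroObject D]
    {F : C ⥤ D} {G : D ⥤ C} (adj : F ⊣ G) [G.ReflectsIsomorphisms]
    {ι : Type*} (S : ι → C)
    (hS : ∀ X : C, (∀ (i : ι) (f : S i ⟶ X), f = 0) → IsZero X)
    (Y : D) (hY : ∀ (i : ι) (f : F.obj (S i) ⟶ Y), f = 0) :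
    IsZero Y := by
  haveI := adj.isRightAdjoint
  have hG : IsZero (G.obj Y) := by
    apply hS
    intro i f
    rw [← (adj.homEquiv (S i) Y).apply_symm_apply f, hY i ((adj.homEquiv (S i) Y).symm f)]
    simp [Adjunction.homEquiv_unit]
  obtain ⟨Z, hZ⟩ := HasZeroObject.zero (C := D)
  have hGZ : IsZero (G.obj Z) := G.map_isZero hZ
  haveI : IsIso (G.map (0 : Y ⟶ Z)) := by
    refine ⟨0, hG.eq_of_src _ _, hGZ.eq_of_src _ _⟩
  haveI : IsIso (0 : Y ⟶ Z) := isIso_of_reflects_iso _ G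
  exact hZ.of_iso (asIso (0 : Y ⟶ Z))
end

section
/- Let C and D be preadditive categories with zero objects admitting all small coproducts, let F : C ⥤ D and G : D ⥤ C be additive functors together with an adjunction F ⊣ G, and assume G is conservative and preserves small coproducts. Suppose S is a family of objects of C such that (i) every A ∈ S is compact, i.e., for every small family (B_j)_{j∈J} in C the canonical group homomorphism ⨁_{j∈J} Hom(A, B_j) → Hom(A, ∐_{j∈J} B_j) is bijective, and (ii) any object X of C admitting only the zero morphism A ⟶ X for every A ∈ S is a zero object. Then the family {F(A) : A ∈ S} of objects of D satisfies the same two properties: each F(A) is compact in D, and any object Y of D admitting only the zero morphism F(A) ⟶ Y for every A ∈ S is a zero object. -/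
/-!
Let `C`, `D` be preadditive categories with zero objects and all small
coproducts, `F ⊣ G` an adjunction of additive functors with `G` conservative
and preserving small coproducts.  If `S` is a family of compact objects of `C`
detecting zero objects, then the family `F(S i)` consists of compact objects
of `D` and detects zero objects of `D`.
-/

open CategoryTheory CategoryTheory.Limits

universe w v₁ v₂ u₁ u₂

/-- The canonical group homomorphism `⨁ⱼ Hom(A, Bⱼ) →+ Hom(A, ∐ⱼ Bⱼ)`, sending
the `j`-th summand to composition with the coproduct inclusion. -/
noncomputable def coproductComparisonHom {C : Type u₁} [Category.{v₁} C] [Preadditive C]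
    {J : Type w} [DecidableEq J] (A : C) (B : J → C) [HasCoproduct B] :
    DirectSum J (fun j => A ⟶ B j) →+ (A ⟶ ∐ B) :=
  DirectSum.toAddMonoid fun j =>
    { toFun := fun f => f ≫ Sigma.ι B j
      map_zero' := by simp
      map_add' := fun f g => by simp [Preadditive.add_comp] }

/-- An object `A` of a preadditive category with all small coproducts is compact if for
every small family `(Bⱼ)ⱼ` the canonical group homomorphism
`⨁ⱼ Hom(A, Bⱼ) → Hom(A, ∐ⱼ Bⱼ)` is bijective. -/
def IsCompactObj.{w', v, u} {C : Type u} [Category.{v} C] [Preadditive C]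
    [HasCoproducts.{w'} C] (A : C) : Prop :=
  ∀ (J : Type w') (B : J → C),
    letI := Classical.decEq J
    Function.Bijective ⇑(coproductComparisonHom A B)

theorem leftAdjoint_image_compact_generators {C : Type u₁} {D : Type u₂}
    [Category.{v₁} C] [Category.{v₂} D] [Preadditive C] [Preadditive D]
    [HasZeroObject C] [HasZeroObject D]
    [HasCoproducts.{w} C] [HasCoproducts.{w} D]
    (F : C ⥤ D) (G : D ⥤ C) [F.Additive] [G.Additive] (adj : F ⊣ G)
    [G.ReflectsIsomorphisms]
    [∀ J : Type w, PreservesColimitsOfShape (Discrete J) G]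
    {ι : Type*} (S : ι → C)
    (hcompact : ∀ i : ι, IsCompactObj.{w} (S i))
    (hdetect : ∀ X : C, (∀ (i : ι) (f : S i ⟶ X), f = 0) → IsZero X) :
    (∀ i : ι, IsCompactObj.{w} (F.obj (S i))) ∧
      (∀ Y : D, (∀ (i : ι) (f : F.obj (S i) ⟶ Y), f = 0) → IsZero Y) := by
  refine ⟨fun i J B => ?_, fun Y hY => ?_⟩
  · let _ := Classical.decEq J
    have h := hcompact i J (fun j => G.obj (B j))
    let e : ∀ j, (F.obj (S i) ⟶ B j) ≃+ (S i ⟶ G.obj (B j)) := fun j => adj.homAddEquiv _ _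
    let m := DirectSum.map (fun j => (e j).toAddMonoidHom)
    have hm : Function.Bijective m :=
      ⟨(DirectSum.map_injective _).2 fun j => (e j).injective,
        (DirectSum.map_surjective _).2 fun j => (e j).surjective⟩
    let c : (S i ⟶ ∐ fun j => G.obj (B j)) →+ (S i ⟶ G.obj (∐ B)) :=
      Preadditive.rightComp (S i) (sigmaComparison G B)
    have hc : Function.Bijective c :=
      ⟨fun a b hab => (cancel_mono (sigmaComparison G B)).1 hab,
        fun a => ⟨a ≫ inv (sigmaComparison G B), by
          change (a ≫ inv (sigmaComparison G B)) ≫ sigmaComparison G B = a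
          simp⟩⟩
    have key : (adj.homAddEquiv (S i) (∐ B)).toAddMonoidHom.comp
        (coproductComparisonHom (F.obj (S i)) B) =
        (c.comp (coproductComparisonHom (S i) (fun j => G.obj (B j)))).comp m := by
      refine DirectSum.addHom_ext fun j f => ?_
      simp [c, m, e, coproductComparisonHom, Adjunction.homEquiv_naturality_right]
      change _ = (_ ≫ _) ≫ sigmaComparison G B
      simp
    have hb : Function.Bijective ((adj.homAddEquiv (S i) (∐ B)) ∘
        (coproductComparisonHom (F.obj (S i)) B)) := by
      have := (hc.comp h).comp hm
      convert this using 1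
      exact congrArg (fun (q : _ →+ _) => (q : _ → _)) key
    exact (Function.Bijective.of_comp_iff' (adj.homAddEquiv (S i) (∐ B)).bijective _).1 hb
  · have hG : IsZero (G.obj Y) := hdetect _ fun i f => by
      apply (adj.homAddEquiv _ _).symm.injective
      rw [map_zero]
      exact hY i _
    obtain ⟨Z, hZ⟩ := HasZeroObject.zero (C := D)
    have h0 : IsZero (G.obj Z) := G.map_isZero hZ
    have : IsIso (G.map (0 : Y ⟶ Z)) := ⟨0, hG.eq_of_src _ _, h0.eq_of_src _ _⟩
    have : IsIso (0 : Y ⟶ Z) := isIso_of_reflects_iso _ G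
    exact hZ.of_iso (asIso (0 : Y ⟶ Z))
end

section
/- Let F : C ⥤ D and G : D ⥤ C be functors with an adjunction adj : F ⊣ G, and let F' : C' ⥤ D' and G' : D' ⥤ C' be functors with an adjunction adj' : F' ⊣ G'. Let u : C ⥤ C' and v : D ⥤ D' be conservative functors, let α : u ⋙ F' ⟶ F ⋙ v be a natural transformation, and let β : G ⋙ u ⟶ v ⋙ G' be the mate (conjugate transformation) of α with respect to the adjunctions adj and adj'. If α and β are natural isomorphisms and the unit and counit of adj' are isomorphisms, then the unit and counit of adj are isomorphisms; in particular F is an equivalence of categories. -/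
/-!
Transport of adjoint equivalences along conservative functors: given
adjunctions `adj : F ⊣ G` and `adj' : F' ⊣ G'`, conservative functors
`u : C ⥤ C'`, `v : D ⥤ D'`, a natural transformation `α : u ⋙ F' ⟶ F ⋙ v`
whose mate `β : G ⋙ u ⟶ v ⋙ G'` (with respect to `adj`, `adj'`) is also an
isomorphism, if the unit and counit of `adj'` are isomorphisms then so are the
unit and counit of `adj`; in particular `F` is an equivalence of categories.
-/

open CategoryTheory

theorem unit_counit_isIso_of_conservative
    {C D C' D' : Type*} [Category C] [Category D] [Category C'] [Category D']
    {F : C ⥤ D} {G : D ⥤ C} (adj : F ⊣ G)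
    {F' : C' ⥤ D'} {G' : D' ⥤ C'} (adj' : F' ⊣ G')
    (u : C ⥤ C') (v : D ⥤ D') [u.ReflectsIsomorphisms] [v.ReflectsIsomorphisms]
    (α : u ⋙ F' ⟶ F ⋙ v) (hα : IsIso α)
    (hβ : IsIso (mateEquiv adj adj' α))
    (hu : IsIso adj'.unit) (hc : IsIso adj'.counit) :
    IsIso adj.unit ∧ IsIso adj.counit ∧ F.IsEquivalence := by
  have hα' : ∀ c, IsIso (α.app c) := fun c => inferInstance
  have hβ' : ∀ d, IsIso (NatTrans.app (F := G ⋙ u) (G := v ⋙ G') (mateEquiv adj adj' α) d) :=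
    fun d => (NatTrans.isIso_iff_isIso_app _).1 hβ d
  have h1 : IsIso adj.unit := by
    rw [NatTrans.isIso_iff_isIso_app]
    intro c
    have key : u.map (adj.unit.app c) ≫
        NatTrans.app (F := G ⋙ u) (G := v ⋙ G') (mateEquiv adj adj' α) (F.obj c) =
        adj'.unit.app (u.obj c) ≫ G'.map (α.app c) := unit_mateEquiv adj adj' α c
    have h3 : IsIso (adj'.unit.app (u.obj c) ≫ G'.map (α.app c)) := inferInstance
    rw [← key] at h3
    have := hβ' (F.obj c)
    have : IsIso (u.map (adj.unit.app c)) := IsIso.of_isIso_comp_right _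
      (NatTrans.app (F := G ⋙ u) (G := v ⋙ G') (mateEquiv adj adj' α) (F.obj c))
    exact isIso_of_reflects_iso _ u
  have h2 : IsIso adj.counit := by
    rw [NatTrans.isIso_iff_isIso_app]
    intro d
    have key : F'.map (NatTrans.app (F := G ⋙ u) (G := v ⋙ G') (mateEquiv adj adj' α) d) ≫
        adj'.counit.app (v.obj d) = α.app (G.obj d) ≫ v.map (adj.counit.app d) :=
      mateEquiv_counit adj adj' α d
    have := hβ' d
    have h3 : IsIso (F'.map (NatTrans.app (F := G ⋙ u) (G := v ⋙ G')
      (mateEquiv adj adj' α) d) ≫ adj'.counit.app (v.obj d)) := inferInstance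
    rw [key] at h3
    have : IsIso (v.map (adj.counit.app d)) := IsIso.of_isIso_comp_left (α.app (G.obj d)) _
    exact isIso_of_reflects_iso _ v
  exact ⟨h1, h2, adj.toEquivalence.isEquivalence_functor⟩
end
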